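/- If T_1 and T_2 are binary phylogenetic trees on the same leaf set X with |X| ≥ 4, and Q(T_1) = Q(T_2) (they display exactly the same set of quartets), then T_1 and T_2 are isomorphic as leaf-labeled trees. -/

import Mathlib

open SimpleGraph

variable {V : Type*}

/-- `x` and `y` are joined by a walk in `G` avoiding the vertex set `S`. -/
def Avoids (G : SimpleGraph V) (S : Set V) (x y : V) : Prop :=
  ∃ w : G.Walk x y, ∀ u ∈ w.support, u ∉ S

/-- `x` and `y` are joined by a walk in `G` avoiding the edge set `F`. -/
def AvoidsE (G : SimpleGraph V) (F : Set (Sym2 V)) (x y : V) : Prop :=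
  ∃ w : G.Walk x y, ∀ e ∈ w.edges, e ∉ F

/-- A leaf of a tree: a vertex with exactly one neighbour (degree one). -/
def IsLeaf (G : SimpleGraph V) (v : V) : Prop := ∃! u, G.Adj v u

/-- An internal vertex of degree three: exactly three distinct neighbours. -/
def IsDeg3 (G : SimpleGraph V) (v : V) : Prop :=
  ∃ a b c, a ≠ b ∧ a ≠ c ∧ b ≠ c ∧ G.Adj v a ∧ G.Adj v b ∧ G.Adj v c ∧
    ∀ u, G.Adj v u → u = a ∨ u = b ∨ u = c

/-- An unrooted binary phylogenetic tree: a tree all of whose vertices are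
leaves (degree 1) or internal vertices of degree 3. -/
def IsBinaryTree (G : SimpleGraph V) : Prop :=
  G.IsTree ∧ ∀ v, IsLeaf G v ∨ IsDeg3 G v

/-- The tree displays the quartet `ab|cd`: there are vertex-disjoint walks
joining `a` to `b` and `c` to `d`. -/
def Displays (G : SimpleGraph V) (a b c d : V) : Prop :=
  ∃ (p : G.Walk a b) (q : G.Walk c d), ∀ u ∈ p.support, u ∉ q.support

/-- The quartet `ab|cd` distinguishes the path `p` between internal vertices
`v1` and `v2`: `{a,b}` and `{c,d}` lie in different connected components of
the graph obtained by removing the path `p`, the `a`–`b` path passes through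
`v1`, and the `c`–`d` path passes through `v2`. -/
def DistPath (G : SimpleGraph V) (a b c d v1 v2 : V) : Prop :=
  ∃ p : G.Walk v1 v2, p.IsPath ∧
    AvoidsE G {e | e ∈ p.edges} a b ∧ AvoidsE G {e | e ∈ p.edges} c d ∧
    ¬ AvoidsE G {e | e ∈ p.edges} a c ∧
    ¬ Avoids G {v1} a b ∧ ¬ Avoids G {v2} c d

variable {X : Type*}

/-- The labelled tree `(G, ℓ)` displays the quartet `q` on the taxa `X`. -/
def DisplaysQ (G : SimpleGraph V) (ℓ : X → V) (q : Sym2 (Sym2 X)) : Prop :=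
  ∃ a b c d : X, a ≠ b ∧ a ≠ c ∧ a ≠ d ∧ b ≠ c ∧ b ≠ d ∧ c ≠ d ∧
    q = s(s(a, b), s(c, d)) ∧ Displays G (ℓ a) (ℓ b) (ℓ c) (ℓ d)

/-- The quartet `q` distinguishes the path between `v1` and `v2` in the
labelled tree `(G, ℓ)`. -/
def QDist (G : SimpleGraph V) (ℓ : X → V) (q : Sym2 (Sym2 X)) (v1 v2 : V) : Prop :=
  ∃ a b c d : X, q = s(s(a, b), s(c, d)) ∧ DistPath G (ℓ a) (ℓ b) (ℓ c) (ℓ d) v1 v2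

/-- The support (taxon set) of a quartet. -/
def suppQ (q : Sym2 (Sym2 X)) : Set X := {x | ∃ p ∈ q, x ∈ p}

/-- Two quartets are linked (there is an edge between them in the graph
`G_T(L)`): they distinguish adjacent internal edges of the tree and the union
of their supports has cardinality 5. -/
def LinkedQ (G : SimpleGraph V) (ℓ : X → V) (q q' : Sym2 (Sym2 X)) : Prop :=
  ∃ u v w : V, u ≠ w ∧ G.Adj u v ∧ G.Adj v w ∧
    (QDist G ℓ q u v ∨ QDist G ℓ q v u) ∧
    (QDist G ℓ q' v w ∨ QDist G ℓ q' w v) ∧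
    (suppQ q ∪ suppQ q').ncard = 5

/-- The set of quartets on the taxa `X` displayed by the labelled tree
`(G, ℓ)`. -/
def QuartetSetL (G : SimpleGraph V) (ℓ : X → V) : Set (Sym2 (Sym2 X)) :=
  {q | DisplaysQ G ℓ q}

section Helpers

variable {G : SimpleGraph V}

lemma av_ne_left {v x y : V} (h : Avoids G {v} x y) : x ≠ v := by
  obtain ⟨w, hw⟩ := h
  exact fun e => hw x w.start_mem_support e

lemma av_symm {v x y : V} (h : Avoids G {v} x y) : Avoids G {v} y x := by
  obtain ⟨w, hw⟩ := h
  exact ⟨w.reverse, fun u hu => hw u (by simpa using hu)⟩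

lemma av_ne_right {v x y : V} (h : Avoids G {v} x y) : y ≠ v := av_ne_left (av_symm h)

lemma av_refl {v x : V} (h : x ≠ v) : Avoids G {v} x x :=
  ⟨Walk.nil, fun u hu => by simp at hu; subst hu; simpa using h⟩

lemma av_trans {v x y z : V} (h : Avoids G {v} x y) (h' : Avoids G {v} y z) :
    Avoids G {v} x z := by
  obtain ⟨w, hw⟩ := h
  obtain ⟨w', hw'⟩ := h'
  refine ⟨w.append w', fun u hu => ?_⟩
  rw [Walk.mem_support_append_iff] at hu
  rcases hu with hu | hu
  · exact hw u hu
  · exact hw' u hu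

lemma av_adj {v x y : V} (h : G.Adj x y) (hx : x ≠ v) (hy : y ≠ v) : Avoids G {v} x y :=
  ⟨h.toWalk, fun u hu => by
    simp at hu
    rcases hu with rfl | rfl <;> simpa⟩

/-- prefix of a path avoids its endpoint -/
lemma av_path {x v u : V} (p : G.Walk x v) (hp : p.IsPath) (hu : u ∈ p.support) (hne : u ≠ v) :
    Avoids G {v} x u := by
  classical
  refine ⟨p.takeUntil u hu, fun z hz e => ?_⟩
  have e : z = v := e
  subst e
  exact Walk.endpoint_notMem_support_takeUntil hp hu (Ne.symm hne) hz

lemma av_step (hG : G.Connected) {v x : V} (h : x ≠ v) : 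
    ∃ n, G.Adj v n ∧ Avoids G {v} n x := by
  obtain ⟨p, hp⟩ := (hG v x).exists_isPath
  cases p with
  | nil => exact absurd rfl h
  | cons hadj q =>
    rw [Walk.cons_isPath_iff] at hp
    exact ⟨_, hadj, q, fun u hu e => hp.2 (by have e : u = v := e; exact e ▸ hu)⟩

lemma av_nbr (hG : G.IsAcyclic) {v n m : V} (hn : G.Adj v n) (hm : G.Adj v m)
    (h : Avoids G {v} n m) : n = m := by
  classical
  obtain ⟨w, hw⟩ := h
  have hv : v ∉ w.bypass.support := fun hv => hw v (w.support_bypass_subset hv) rfl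
  have h1 : (Walk.cons hn w.bypass).IsPath := (Walk.cons_isPath_iff _ _).2 ⟨w.bypass_isPath, hv⟩
  have h2 : (Walk.cons hm Walk.nil : G.Walk v m).IsPath := by
    simp [Walk.cons_isPath_iff, hm.ne]
  have := congrArg Subtype.val (hG.path_unique ⟨_, h1⟩ ⟨_, h2⟩)
  have h3 := congrArg Walk.support this
  have h4 : n ∈ (Walk.cons hm Walk.nil : G.Walk v m).support := by
    rw [← h3]; simp
  simp at h4
  rcases h4 with rfl | rfl
  · exact absurd hn (G.loopless.irrefl _)
  · rfl

lemma av_or (hG : G.Connected) {u v : V} (huv : u ≠ v) (x : V) :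
    Avoids G {v} u x ∨ Avoids G {u} v x := by
  classical
  obtain ⟨p, hp⟩ := (hG x u).exists_isPath
  by_cases hv : v ∈ p.support
  · right
    exact av_symm (av_path p hp hv huv.symm)
  · left
    exact av_symm ⟨p, fun z hz e => hv (by have e : z = v := e; exact e ▸ hz)⟩

lemma av_not_both (hG : G.IsAcyclic) {u v x : V} (h : G.Adj u v)
    (h1 : Avoids G {v} u x) (h2 : Avoids G {u} v x) : False := by
  classical
  obtain ⟨w1, hw1⟩ := av_symm h1
  obtain ⟨w2, hw2⟩ := av_symm h2
  have hv : v ∉ w1.bypass.support := fun hv => hw1 v (w1.support_bypass_subset hv) rfl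
  have hp : (w1.bypass.concat h).IsPath := (Walk.concat_isPath_iff _).2 ⟨w1.bypass_isPath, hv⟩
  have := congrArg Subtype.val (hG.path_unique ⟨_, hp⟩ ⟨_, w2.bypass_isPath⟩)
  have h3 := congrArg Walk.support this
  have hu : u ∈ w2.bypass.support := by
    rw [← h3]; simp [Walk.support_concat]
  exact hw2 u (w2.support_bypass_subset hu) rfl

lemma av_sep_dist (hG : G.Connected) {v x y : V} (hxy : x ≠ y) (h : ¬ Avoids G {x} v y) :
    G.dist v x < G.dist v y := by
  classical
  obtain ⟨p, hp⟩ := hG.exists_walk_length_eq_dist v y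
  have hx : x ∈ p.support := by
    by_contra hx
    exact h ⟨p, fun z hz e => hx (by have e : z = x := e; exact e ▸ hz)⟩
  rw [← hp]
  refine lt_of_le_of_lt (SimpleGraph.dist_le (p.takeUntil x hx)) ?_
  exact Walk.length_takeUntil_lt hx hxy

lemma leaf_av (hG : G.Connected) {v x y : V} (hv : IsLeaf G v) (hx : x ≠ v) (hy : y ≠ v) :
    Avoids G {v} x y := by
  obtain ⟨n, hn, hn2⟩ := av_step hG hx
  obtain ⟨m, hm, hm2⟩ := av_step hG hy
  obtain rfl := hv.unique hn hm
  exact av_trans (av_symm hn2) hm2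

/-- a vertex not in `p`'s or `q`'s branch -/
lemma third_nbr (hG : IsBinaryTree G) {v : V} (hv : ¬ IsLeaf G v) (p q : V) :
    ∃ n, G.Adj v n ∧ ¬ Avoids G {v} n p ∧ ¬ Avoids G {v} n q := by
  obtain ⟨a, b, c, hab, hac, hbc, ha, hb, hc, -⟩ := (hG.2 v).resolve_left hv
  have key : ∀ {n m p : V}, G.Adj v n → G.Adj v m → n ≠ m → Avoids G {v} n p →
      ¬ Avoids G {v} m p := fun hn hm hne h1 h2 =>
    hne (av_nbr hG.1.2 hn hm (av_trans h1 (av_symm h2)))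
  by_contra! hcon
  have h1 := hcon a ha
  have h2 := hcon b hb
  have h3 := hcon c hc
  have k1 := fun p => key (p := p) ha hb hab
  have k2 := fun p => key (p := p) ha hc hac
  have k3 := fun p => key (p := p) hb hc hbc
  have := k1 p; have := k2 p; have := k3 p
  have := k1 q; have := k2 q; have := k3 q
  tauto

lemma exists_leaf [Finite V] (hG : IsBinaryTree G) {v n : V} (hn : n ≠ v) :
    ∃ x, IsLeaf G x ∧ Avoids G {v} n x := by
  obtain ⟨x, hx, hmax⟩ := Set.exists_max_image {x | Avoids G {v} n x} (fun x => G.dist v x)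
    (Set.toFinite _) ⟨n, av_refl hn⟩
  refine ⟨x, ?_, hx⟩
  by_contra hl
  obtain ⟨y, hy, hy1, -⟩ := third_nbr hG hl v v
  have hlt := av_sep_dist hG.1.1 hy.ne (fun h => hy1 (av_symm h))
  have hyv : y ≠ v := by
    rintro rfl
    simp at hlt
  exact absurd (hmax y (av_trans hx (av_adj hy (av_ne_right hx) hyv))) (not_le.2 hlt)

lemma third_leaf [Finite V] (hG : IsBinaryTree G) {v : V} (hv : ¬ IsLeaf G v) (p q : V) :
    ∃ x, IsLeaf G x ∧ ¬ Avoids G {v} x p ∧ ¬ Avoids G {v} x q := by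
  obtain ⟨n, hn, h1, h2⟩ := third_nbr hG hv p q
  obtain ⟨x, hx, h⟩ := exists_leaf hG hn.ne'
  exact ⟨x, hx, fun h' => h1 (av_trans h h'), fun h' => h2 (av_trans h h')⟩

/-- in a degree three vertex, three separated vertices cover all branches -/
lemma three_cover (hG : IsBinaryTree G) {v a b c : V} (hv : ¬ IsLeaf G v)
    (ha : a ≠ v) (hb : b ≠ v) (hc : c ≠ v)
    (hab : ¬ Avoids G {v} a b) (hac : ¬ Avoids G {v} a c) (hbc : ¬ Avoids G {v} b c)
    {x : V} (hx : x ≠ v) :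
    Avoids G {v} x a ∨ Avoids G {v} x b ∨ Avoids G {v} x c := by
  obtain ⟨r, s, t, -, -, -, -, -, -, hall⟩ := (hG.2 v).resolve_left hv
  obtain ⟨na, ha1, ha2⟩ := av_step hG.1.1 ha
  obtain ⟨nb, hb1, hb2⟩ := av_step hG.1.1 hb
  obtain ⟨nc, hc1, hc2⟩ := av_step hG.1.1 hc
  obtain ⟨nx, hx1, hx2⟩ := av_step hG.1.1 hx
  have e1 : na ≠ nb := by rintro rfl; exact hab (av_trans (av_symm ha2) hb2)
  have e2 : na ≠ nc := by rintro rfl; exact hac (av_trans (av_symm ha2) hc2)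
  have e3 : nb ≠ nc := by rintro rfl; exact hbc (av_trans (av_symm hb2) hc2)
  have e : nx = na ∨ nx = nb ∨ nx = nc := by
    have := hall _ ha1; have := hall _ hb1; have := hall _ hc1; have := hall _ hx1
    grind
  rcases e with rfl | rfl | rfl
  · exact Or.inl (av_trans (av_symm hx2) ha2)
  · exact Or.inr (Or.inl (av_trans (av_symm hx2) hb2))
  · exact Or.inr (Or.inr (av_trans (av_symm hx2) hc2))

lemma median_aux (hG : G.IsTree) {a b c v : V} (hv : ¬ Avoids G {v} a b)
    (hmin : ∀ w, ¬ Avoids G {w} a b → G.dist c v ≤ G.dist c w) : ¬ Avoids G {v} a c := by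
  intro hac
  obtain ⟨n, hn, hnc⟩ := av_step hG.1 (av_ne_right hac)
  have hna := av_trans hnc (av_symm hac)
  have h1 : ¬ Avoids G {n} v a := fun h => av_not_both hG.2 hn h hna
  have h2 : Avoids G {n} v b := (av_or hG.1 hn.ne b).resolve_right
    (fun h => hv (av_trans (av_symm hna) h))
  have h3 : ¬ Avoids G {n} a b := fun h => h1 (av_trans h2 (av_symm h))
  have h4 : ¬ Avoids G {n} v c := fun h => av_not_both hG.2 hn h hnc
  exact absurd (hmin n h3) (not_le.2 (av_sep_dist hG.1 hn.ne' fun h => h4 (av_symm h)))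

lemma median [Finite V] (hG : G.IsTree) (a b c : V) :
    ∃ v, ¬ Avoids G {v} a b ∧ ¬ Avoids G {v} a c ∧ ¬ Avoids G {v} b c := by
  obtain ⟨v, hv, hmin⟩ := Set.exists_min_image {v | ¬ Avoids G {v} a b} (fun x => G.dist c x)
    (Set.toFinite _) ⟨a, fun h => av_ne_left h rfl⟩
  refine ⟨v, hv, median_aux hG hv hmin, median_aux hG (fun h => hv (av_symm h)) ?_⟩
  exact fun w hw => hmin w fun h => hw (av_symm h)

lemma median_not_leaf (hG : G.Connected) {v a b c : V} (nab : a ≠ b) (nac : a ≠ c) (nbc : b ≠ c)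
    (hab : ¬ Avoids G {v} a b) (hac : ¬ Avoids G {v} a c) (hbc : ¬ Avoids G {v} b c) :
    ¬ IsLeaf G v := by
  intro hl
  have h1 := fun h h' => hab (leaf_av hG hl h h')
  have h2 := fun h h' => hac (leaf_av hG hl h h')
  have h3 := fun h h' => hbc (leaf_av hG hl h h')
  by_cases ha : a = v
  · exact h3 (fun e => nab (ha.trans e.symm)) (fun e => nac (ha.trans e.symm))
  · by_cases hb : b = v
    · exact h2 ha (fun e => nbc (hb.trans e.symm))
    · exact h1 ha hb

lemma displays_iff (hG : G.Connected) {v x a b c : V}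
    (hab : ¬ Avoids G {v} a b) (hac : ¬ Avoids G {v} a c) (hbc : ¬ Avoids G {v} b c) :
    Displays G x a b c ↔ Avoids G {v} x a := by
  classical
  constructor
  · rintro ⟨p, q, hpq⟩
    have hv : v ∈ q.support := by
      by_contra hv
      exact hbc ⟨q, fun z hz e => hv (by have e : z = v := e; exact e ▸ hz)⟩
    exact ⟨p, fun u hu e => hpq u hu (by have e : u = v := e; exact e ▸ hv)⟩
  · rintro ⟨p, hp⟩
    obtain ⟨q1, hq1⟩ := (hG b v).exists_isPath
    obtain ⟨q2, hq2⟩ := (hG c v).exists_isPath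
    have hpa : ∀ u ∈ p.support, Avoids G {v} u a := fun u hu =>
      ⟨p.dropUntil u hu, fun z hz => hp z (p.support_dropUntil_subset hu hz)⟩
    refine ⟨p, q1.append q2.reverse, fun u hu hu' => ?_⟩
    have huv : u ≠ v := fun e => hp u hu e
    rw [Walk.mem_support_append_iff] at hu'
    rcases hu' with hu' | hu'
    · exact hab (av_symm (av_trans (av_path q1 hq1 hu' huv) (hpa u hu)))
    · rw [Walk.support_reverse, List.mem_reverse] at hu'
      exact hac (av_symm (av_trans (av_path q2 hq2 hu' huv) (hpa u hu)))

lemma disp_swap1 {a b c d : V} (h : Displays G a b c d) : Displays G b a c d := by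
  obtain ⟨p, q, h⟩ := h
  exact ⟨p.reverse, q, fun u hu => h u (by simpa using hu)⟩

lemma disp_swap {a b c d : V} (h : Displays G a b c d) : Displays G c d a b := by
  obtain ⟨p, q, h⟩ := h
  exact ⟨q, p, fun u hu hu' => h u hu' hu⟩

lemma disp_swap2 {a b c d : V} (h : Displays G a b c d) : Displays G a b d c :=
  disp_swap (disp_swap1 (disp_swap h))

lemma displaysQ_iff {ℓ : X → V} {a b c d : X} (h1 : a ≠ b) (h2 : a ≠ c) (h3 : a ≠ d)
    (h4 : b ≠ c) (h5 : b ≠ d) (h6 : c ≠ d) :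
    s(s(a, b), s(c, d)) ∈ QuartetSetL G ℓ ↔ Displays G (ℓ a) (ℓ b) (ℓ c) (ℓ d) := by
  constructor
  · rintro ⟨a', b', c', d', -, -, -, -, -, -, he, h⟩
    simp only [Sym2.eq_iff] at he
    rcases he with ⟨⟨rfl, rfl⟩ | ⟨rfl, rfl⟩, ⟨rfl, rfl⟩ | ⟨rfl, rfl⟩⟩ |
      ⟨⟨rfl, rfl⟩ | ⟨rfl, rfl⟩, ⟨rfl, rfl⟩ | ⟨rfl, rfl⟩⟩
    · exact h
    · exact disp_swap2 h
    · exact disp_swap1 h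
    · exact disp_swap1 (disp_swap2 h)
    · exact disp_swap h
    · exact disp_swap (disp_swap1 h)
    · exact disp_swap (disp_swap2 h)
    · exact disp_swap (disp_swap1 (disp_swap2 h))
  · intro h
    exact ⟨a, b, c, d, h1, h2, h3, h4, h5, h6, rfl, h⟩

/-- the partition relation on taxa induced by a vertex -/
def Rl (G : SimpleGraph V) (ℓ : X → V) (v : V) (x y : X) : Prop :=
  x = y ∨ Avoids G {v} (ℓ x) (ℓ y)

lemma ex_third [Finite X] (hX : 4 ≤ Nat.card X) (x y : X) : ∃ z, z ≠ x ∧ z ≠ y := by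
  classical
  have := Fintype.ofFinite X
  rw [Nat.card_eq_fintype_card] at hX
  by_contra! h
  have h2 : (Finset.univ : Finset X) ⊆ {x, y} := fun z _ => by
    have := h z
    simp; tauto
  have h3 := Finset.card_le_card h2
  have h4 := Finset.card_le_two (a := x) (b := y)
  rw [Finset.card_univ] at h3
  omega

lemma Rl_leaf (hG : G.Connected) {ℓ : X → V} (hinj : Function.Injective ℓ) {x : X}
    (hx : IsLeaf G (ℓ x)) (y z : X) : Rl G ℓ (ℓ x) y z ↔ y = z ∨ (y ≠ x ∧ z ≠ x) := by
  constructor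
  · rintro (h | h)
    · exact Or.inl h
    · exact Or.inr ⟨fun e => av_ne_left h (e ▸ rfl), fun e => av_ne_right h (e ▸ rfl)⟩
  · rintro (h | h)
    · exact Or.inl h
    · exact Or.inr (leaf_av hG hx (fun e => h.1 (hinj e)) (fun e => h.2 (hinj e)))

lemma Rl_inj [Finite V] [Finite X] (hX : 4 ≤ Nat.card X) (hG : IsBinaryTree G) {ℓ : X → V}
    (hinj : Function.Injective ℓ) (hr : Set.range ℓ = {v | IsLeaf G v}) {v w : V}
    (h : ∀ x y, Rl G ℓ v x y ↔ Rl G ℓ w x y) : v = w := by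
  have hlab : ∀ x, IsLeaf G x → ∃ y, ℓ y = x := fun x hx => by
    have : x ∈ Set.range ℓ := by rw [hr]; exact hx
    exact this
  by_contra hne
  have key : ∀ v w, v ≠ w → (∀ x y, Rl G ℓ v x y ↔ Rl G ℓ w x y) → IsLeaf G v := by
    intro v w hne h
    by_contra hv
    obtain ⟨b, hb, hb1, -⟩ := third_leaf hG hv w w
    obtain ⟨c, hc, hc1, hc2⟩ := third_leaf hG hv w b
    have e1 := (av_or hG.1.1 hne b).resolve_right (fun h => hb1 (av_symm h))
    have e2 := (av_or hG.1.1 hne c).resolve_right (fun h => hc1 (av_symm h))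
    obtain ⟨b, rfl⟩ := hlab b hb
    obtain ⟨c, rfl⟩ := hlab c hc
    have hbv : ℓ b ≠ v := fun e => hv (e ▸ hb)
    rcases (h c b).2 (Or.inr (av_trans (av_symm e2) e1)) with e | e
    · subst e; exact hc2 (av_refl hbv)
    · exact hc2 e
  have hv := key v w hne h
  have hw := key w v (Ne.symm hne) (fun x y => (h x y).symm)
  obtain ⟨x, rfl⟩ := hlab v hv
  obtain ⟨y, rfl⟩ := hlab w hw
  obtain ⟨z, hzx, hzy⟩ := ex_third hX x y
  have h1 := h y z
  rw [Rl_leaf hG.1.1 hinj hv, Rl_leaf hG.1.1 hinj hw] at h1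
  have hxy : y ≠ x := fun e => hne (by rw [e])
  grind

lemma Rl_adj [Finite V] [Finite X] (hX : 4 ≤ Nat.card X) (hG : IsBinaryTree G) {ℓ : X → V}
    (hinj : Function.Injective ℓ) (hr : Set.range ℓ = {v | IsLeaf G v}) {u v : V}
    (huv : u ≠ v) : G.Adj u v ↔ ∃ x y, ∀ z, Rl G ℓ u x z ↔ ¬ Rl G ℓ v y z := by
  have hlab : ∀ x, IsLeaf G x → ∃ y, ℓ y = x := fun x hx => by
    have : x ∈ Set.range ℓ := by rw [hr]; exact hx
    exact this
  -- relation for a class containing the direction of a vertex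
  have hR : ∀ {u v x}, Avoids G {u} v (ℓ x) → ∀ z, Rl G ℓ u x z ↔ Avoids G {u} v (ℓ z) := by
    intro u v x h z
    constructor
    · rintro (rfl | h')
      · exact h
      · exact av_trans h h'
    · intro h'
      exact Or.inr (av_trans (av_symm h) h')
  have hR' : ∀ {u v x}, ¬ Avoids G {u} v (ℓ x) → ∀ z, Rl G ℓ u x z → ¬ Avoids G {u} v (ℓ z) := by
    rintro u v x h z (rfl | h')
    · exact h
    · exact fun h'' => h (av_trans h'' (av_symm h'))
  constructor
  · intro hadj
    obtain ⟨x, hx, hx'⟩ := exists_leaf hG huv.symm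
    obtain ⟨y, hy, hy'⟩ := exists_leaf hG huv
    obtain ⟨x, rfl⟩ := hlab x hx
    obtain ⟨y, rfl⟩ := hlab y hy
    refine ⟨x, y, fun z => ?_⟩
    rw [hR hx', hR hy']
    have h1 := av_or hG.1.1 huv (ℓ z)
    have h2 := fun h h' => av_not_both (x := ℓ z) hG.1.2 hadj h h'
    tauto
  · rintro ⟨x, y, h⟩
    have key1 : ∀ {u v x y}, u ≠ v → (∀ z, Rl G ℓ u x z ↔ ¬ Rl G ℓ v y z) →
        ¬ Avoids G {u} v (ℓ x) → ¬ Avoids G {v} u (ℓ y) := by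
      intro u v x y huv h hx hy
      have h1 := (h x).1 (Or.inl rfl)
      rw [hR hy] at h1
      exact h1 ((av_or hG.1.1 huv (ℓ x)).resolve_right hx)
    have key2 : ∀ {u v x y}, u ≠ v → (∀ z, Rl G ℓ u x z ↔ ¬ Rl G ℓ v y z) →
        ¬ Avoids G {u} v (ℓ x) → ¬ Avoids G {v} u (ℓ y) → IsLeaf G u := by
      intro u v x y huv h hx hy
      by_contra hu
      obtain ⟨c, hc, hc1, hc2⟩ := third_leaf hG hu v (ℓ x)
      obtain ⟨c, rfl⟩ := hlab c hc
      have hcu : ℓ c ≠ u := fun e => hu (e ▸ hc)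
      have h1 : ¬ Rl G ℓ u x c := by
        rintro (rfl | h')
        · exact hc2 (av_refl hcu)
        · exact hc2 (av_symm h')
      have h2 : Rl G ℓ v y c := by
        by_contra h2
        exact h1 ((h c).2 h2)
      exact (av_or hG.1.1 huv (ℓ c)).elim (hR' hy c h2) (fun h => hc1 (av_symm h))
    have hsymm : ∀ z, Rl G ℓ v y z ↔ ¬ Rl G ℓ u x z := fun z => by rw [h z, not_not]
    have hx : Avoids G {u} v (ℓ x) := by
      by_contra hx
      have hy := key1 huv h hx
      have hu := key2 huv h hx hy
      have hv := key2 huv.symm hsymm hy hx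
      obtain ⟨a, rfl⟩ := hlab u hu
      obtain ⟨b, rfl⟩ := hlab v hv
      obtain ⟨z, hz1, hz2⟩ := ex_third hX a b
      have hz3 : Avoids G {ℓ a} (ℓ b) (ℓ z) :=
        leaf_av hG.1.1 hu huv.symm (fun e => hz1 (hinj e))
      have hz4 : Avoids G {ℓ b} (ℓ a) (ℓ z) :=
        leaf_av hG.1.1 hv huv (fun e => hz2 (hinj e))
      exact hR' hx z ((h z).2 fun h' => hR' hy z h' hz4) hz3
    have hy : Avoids G {v} u (ℓ y) := by
      by_contra hy
      exact key1 huv.symm hsymm hy hx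
    by_contra hadj
    obtain ⟨n, hn, hnv⟩ := av_step hG.1.1 huv.symm
    have hnv' : n ≠ v := by rintro rfl; exact hadj hn
    have h1 : ¬ Avoids G {n} u v := fun h => av_not_both hG.1.2 hn h hnv
    have hl : ¬ IsLeaf G n := fun hl => h1 (leaf_av hG.1.1 hl hn.ne hnv'.symm)
    obtain ⟨z, hz, hz1, hz2⟩ := third_leaf hG hl u v
    obtain ⟨z, rfl⟩ := hlab z hz
    have h2 : Avoids G {u} n (ℓ z) :=
      (av_or hG.1.1 hn.ne (ℓ z)).resolve_left (fun h => hz1 (av_symm h))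
    have h3 : Avoids G {v} n (ℓ z) :=
      (av_or hG.1.1 hnv' (ℓ z)).resolve_right (fun h => hz2 (av_symm h))
    have h4 : Avoids G {v} n u :=
      (av_or hG.1.1 hnv' u).resolve_right (fun h => h1 (av_symm h))
    have h5 := h z
    rw [hR hx, hR hy] at h5
    exact h5.1 (av_trans (av_symm hnv) h2) (av_trans (av_symm h4) h3)

/-- `a, b, c` lie in the three branches at `v` -/
def Tri (G : SimpleGraph V) (ℓ : X → V) (v : V) (a b c : X) : Prop :=
  ¬ IsLeaf G v ∧ ¬ Avoids G {v} (ℓ a) (ℓ b) ∧ ¬ Avoids G {v} (ℓ a) (ℓ c) ∧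
    ¬ Avoids G {v} (ℓ b) (ℓ c)

lemma Tri.rot {ℓ : X → V} {v : V} {a b c : X} (h : Tri G ℓ v a b c) : Tri G ℓ v b c a :=
  ⟨h.1, h.2.2.2, fun h' => h.2.1 (av_symm h'), fun h' => h.2.2.1 (av_symm h')⟩

lemma Rl_iff_of_tri (hG : IsBinaryTree G) {ℓ : X → V}
    (hr : Set.range ℓ = {v | IsLeaf G v}) {v : V} {a b c : X} (h : Tri G ℓ v a b c) (x y : X) :
    Rl G ℓ v x y ↔ x = y ∨ (Avoids G {v} (ℓ x) (ℓ a) ∧ Avoids G {v} (ℓ y) (ℓ a)) ∨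
      (Avoids G {v} (ℓ x) (ℓ b) ∧ Avoids G {v} (ℓ y) (ℓ b)) ∨
      (Avoids G {v} (ℓ x) (ℓ c) ∧ Avoids G {v} (ℓ y) (ℓ c)) := by
  have hne : ∀ x, ℓ x ≠ v := fun x e => h.1 (by
    have : ℓ x ∈ Set.range ℓ := ⟨x, rfl⟩
    rw [hr] at this
    exact e ▸ this)
  constructor
  · rintro (e | e)
    · exact Or.inl e
    · right
      rcases three_cover hG h.1 (hne a) (hne b) (hne c) h.2.1 h.2.2.1 h.2.2.2 (hne x)
        with k | k | k
      · exact Or.inl ⟨k, av_trans (av_symm e) k⟩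
      · exact Or.inr (Or.inl ⟨k, av_trans (av_symm e) k⟩)
      · exact Or.inr (Or.inr ⟨k, av_trans (av_symm e) k⟩)
  · rintro (e | e | e | e)
    · exact Or.inl e
    all_goals exact Or.inr (av_trans e.1 (av_symm e.2))

lemma branch_iff {V1 V2 : Type*} {G1 : SimpleGraph V1} {G2 : SimpleGraph V2}
    {ℓ1 : X → V1} {ℓ2 : X → V2}
    (hT1 : IsBinaryTree G1) (hT2 : IsBinaryTree G2)
    (hrange1 : Set.range ℓ1 = {v | IsLeaf G1 v})
    (hrange2 : Set.range ℓ2 = {v | IsLeaf G2 v})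
    (hQ : QuartetSetL G1 ℓ1 = QuartetSetL G2 ℓ2) {v1 : V1} {v2 : V2} {a b c : X}
    (nab : a ≠ b) (nac : a ≠ c) (nbc : b ≠ c)
    (h1 : Tri G1 ℓ1 v1 a b c) (h2 : Tri G2 ℓ2 v2 a b c) (x : X) :
    Avoids G1 {v1} (ℓ1 x) (ℓ1 a) ↔ Avoids G2 {v2} (ℓ2 x) (ℓ2 a) := by
  by_cases hxa : x = a
  · subst hxa
    refine iff_of_true (av_refl fun e => h1.1 ?_) (av_refl fun e => h2.1 ?_)
    · have : ℓ1 x ∈ Set.range ℓ1 := ⟨x, rfl⟩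
      rw [hrange1] at this
      exact e ▸ this
    · have : ℓ2 x ∈ Set.range ℓ2 := ⟨x, rfl⟩
      rw [hrange2] at this
      exact e ▸ this
  by_cases hxb : x = b
  · subst hxb
    exact iff_of_false (fun h => h1.2.1 (av_symm h)) (fun h => h2.2.1 (av_symm h))
  by_cases hxc : x = c
  · subst hxc
    exact iff_of_false (fun h => h1.2.2.1 (av_symm h)) (fun h => h2.2.2.1 (av_symm h))
  rw [← displays_iff hT1.1.1 h1.2.1 h1.2.2.1 h1.2.2.2,
    ← displays_iff hT2.1.1 h2.2.1 h2.2.2.1 h2.2.2.2,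
    ← displaysQ_iff hxa hxb hxc nab nac nbc, ← displaysQ_iff hxa hxb hxc nab nac nbc, hQ]

lemma exists_match {V1 V2 : Type*} [Finite V1] [Finite V2]
    {G1 : SimpleGraph V1} {G2 : SimpleGraph V2} {ℓ1 : X → V1} {ℓ2 : X → V2}
    (hT1 : IsBinaryTree G1) (hT2 : IsBinaryTree G2)
    (hinj1 : Function.Injective ℓ1) (hinj2 : Function.Injective ℓ2)
    (hrange1 : Set.range ℓ1 = {v | IsLeaf G1 v})
    (hrange2 : Set.range ℓ2 = {v | IsLeaf G2 v})
    (hQ : QuartetSetL G1 ℓ1 = QuartetSetL G2 ℓ2) (v1 : V1) :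
    ∃ v2, ∀ x y, Rl G1 ℓ1 v1 x y ↔ Rl G2 ℓ2 v2 x y := by
  have hlab : ∀ x, IsLeaf G1 x → ∃ y, ℓ1 y = x := fun x hx => by
    have : x ∈ Set.range ℓ1 := by rw [hrange1]; exact hx
    exact this
  by_cases hv : IsLeaf G1 v1
  · obtain ⟨x, rfl⟩ := hlab v1 hv
    have hv2 : IsLeaf G2 (ℓ2 x) := by
      have : ℓ2 x ∈ Set.range ℓ2 := ⟨x, rfl⟩
      rw [hrange2] at this
      exact this
    refine ⟨ℓ2 x, fun y z => ?_⟩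
    rw [Rl_leaf hT1.1.1 hinj1 hv, Rl_leaf hT2.1.1 hinj2 hv2]
  · obtain ⟨a, ha, -, -⟩ := third_leaf hT1 hv v1 v1
    obtain ⟨b, hb, hb1, -⟩ := third_leaf hT1 hv a a
    obtain ⟨c, hc, hc1, hc2⟩ := third_leaf hT1 hv a b
    have hav : a ≠ v1 := fun e => hv (e ▸ ha)
    have hbv : b ≠ v1 := fun e => hv (e ▸ hb)
    obtain ⟨a, rfl⟩ := hlab a ha
    obtain ⟨b, rfl⟩ := hlab b hb
    obtain ⟨c, rfl⟩ := hlab c hc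
    have nab : a ≠ b := by rintro rfl; exact hb1 (av_refl hav)
    have nac : a ≠ c := by rintro rfl; exact hc1 (av_refl hav)
    have nbc : b ≠ c := by rintro rfl; exact hc2 (av_refl hbv)
    have t1 : Tri G1 ℓ1 v1 a b c := ⟨hv, fun h => hb1 (av_symm h), fun h => hc1 (av_symm h),
      fun h => hc2 (av_symm h)⟩
    obtain ⟨v2, m1, m2, m3⟩ := median hT2.1 (ℓ2 a) (ℓ2 b) (ℓ2 c)
    have t2 : Tri G2 ℓ2 v2 a b c :=
      ⟨median_not_leaf hT2.1.1 (hinj2.ne nab) (hinj2.ne nac) (hinj2.ne nbc) m1 m2 m3, m1, m2, m3⟩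
    refine ⟨v2, fun x y => ?_⟩
    have ba := branch_iff hT1 hT2 hrange1 hrange2 hQ nab nac nbc t1 t2
    have bb := branch_iff hT1 hT2 hrange1 hrange2 hQ nbc nab.symm nac.symm t1.rot t2.rot
    have bc := branch_iff hT1 hT2 hrange1 hrange2 hQ nac.symm nbc.symm nab t1.rot.rot t2.rot.rot
    rw [Rl_iff_of_tri hT1 hrange1 t1, Rl_iff_of_tri hT2 hrange2 t2, ba x, ba y, bb x, bb y,
      bc x, bc y]

end Helpers

/-- If `T₁` and `T₂` are binary phylogenetic trees on the same leaf set `X`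
with `|X| ≥ 4` displaying exactly the same set of quartets, then `T₁` and `T₂`
are isomorphic as leaf-labelled trees. -/
theorem stmt13 {V1 V2 X : Type*} [Fintype V1] [Fintype V2] [Fintype X]
    (G1 : SimpleGraph V1) (G2 : SimpleGraph V2) (ℓ1 : X → V1) (ℓ2 : X → V2)
    (hX : 4 ≤ Nat.card X)
    (hT1 : IsBinaryTree G1) (hT2 : IsBinaryTree G2)
    (hinj1 : Function.Injective ℓ1) (hinj2 : Function.Injective ℓ2)
    (hrange1 : Set.range ℓ1 = {v | IsLeaf G1 v})
    (hrange2 : Set.range ℓ2 = {v | IsLeaf G2 v})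
    (hQ : QuartetSetL G1 ℓ1 = QuartetSetL G2 ℓ2) :
    ∃ φ : G1 ≃g G2, ∀ x, φ (ℓ1 x) = ℓ2 x := by
  choose f hf using exists_match hT1 hT2 hinj1 hinj2 hrange1 hrange2 hQ
  choose g hg using exists_match hT2 hT1 hinj2 hinj1 hrange2 hrange1 hQ.symm
  have hgf : ∀ v, g (f v) = v := fun v => Rl_inj hX hT1 hinj1 hrange1 fun x y => by
    rw [hf v, hg (f v)]
  have hfg : ∀ v, f (g v) = v := fun v => Rl_inj hX hT2 hinj2 hrange2 fun x y => by
    rw [hg v, hf (g v)]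
  refine ⟨⟨⟨f, g, hgf, hfg⟩, ?_⟩, ?_⟩
  · intro u v
    change G2.Adj (f u) (f v) ↔ G1.Adj u v
    by_cases huv : u = v
    · subst huv
      simp
    · have hne : f u ≠ f v := fun e => huv (by rw [← hgf u, e, hgf v])
      rw [Rl_adj hX hT1 hinj1 hrange1 huv, Rl_adj hX hT2 hinj2 hrange2 hne]
      simp only [hf]
  · intro x
    have l1 : IsLeaf G1 (ℓ1 x) := by
      have : ℓ1 x ∈ Set.range ℓ1 := ⟨x, rfl⟩
      rw [hrange1] at this
      exact this
    have l2 : IsLeaf G2 (ℓ2 x) := by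
      have : ℓ2 x ∈ Set.range ℓ2 := ⟨x, rfl⟩
      rw [hrange2] at this
      exact this
    refine Rl_inj hX hT2 hinj2 hrange2 fun y z => ?_
    change Rl G2 ℓ2 (f (ℓ1 x)) y z ↔ _
    rw [← hf, Rl_leaf hT1.1.1 hinj1 l1, Rl_leaf hT2.1.1 hinj2 l2]
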